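/- Let J : ℝ^{n_z} × ℝ^{n_p} → ℝ, G : ℝ^{n_z} × ℝ^{n_p} → ℝ^{n_G}, and H : ℝ^{n_z} × ℝ^{n_p} → ℝ^{n_H} be twice continuously differentiable, let p̂ be a fixed nominal parameter, and let ẑ be a strongly regular local minimum of NLP(p̂) with multipliers μ̂, λ̂. Then the locally defined solution map p ↦ (z*(p), μ*(p), λ*(p)) (the unique nearby strongly regular KKT triple of NLP(p) for p near p̂) is continuously differentiable in a neighborhood of p̂, and its derivative at p̂ satisfies the linear system: ∇²_{zz}L · (z*)'(p̂) + (G'_z)ᵀ (μ*)'(p̂) + (H'_z)ᵀ (λ*)'(p̂) = −∇²_{zp}L; Ξ̂·G'_z·(z*)'(p̂) + Γ̂·(μ*)'(p̂) = −Ξ̂·G'_p; and H'_z·(z*)'(p̂) = −H'_p, where Ξ̂ = diag(μ̂₁,…,μ̂_{n_G}), Γ̂ = diag(G₁(ẑ,p̂),…,G_{n_G}(ẑ,p̂)), and all functions and derivatives are evaluated at (ẑ, μ̂, λ̂, p̂). -/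

import Mathlib

open Metric

/-- The Lagrange function `L(z, μ, λ, p) = J(z,p) + μᵀG(z,p) + λᵀH(z,p)`
of the parametric nonlinear program NLP(p):
minimize `J(z,p)` subject to `H(z,p) = 0` and `G(z,p) ≤ 0`. -/
noncomputable def Lagrangian {nz np nG nH : ℕ}
    (J : (Fin nz → ℝ) → (Fin np → ℝ) → ℝ)
    (G : (Fin nz → ℝ) → (Fin np → ℝ) → Fin nG → ℝ)
    (H : (Fin nz → ℝ) → (Fin np → ℝ) → Fin nH → ℝ)
    (z : Fin nz → ℝ) (μ : Fin nG → ℝ) (lam : Fin nH → ℝ) (p : Fin np → ℝ) : ℝ :=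
  J z p + ∑ i, μ i * G z p i + ∑ j, lam j * H z p j

/-- `zhat` is a strongly regular local minimum of NLP(phat) with Lagrange multipliers
`muhat, lamhat`: `zhat` is a feasible local minimum and (a) LICQ, (b) the KKT conditions,
(c) strict complementarity, and (d) the second-order sufficient condition hold. -/
noncomputable def StronglyRegular {nz np nG nH : ℕ}
    (J : (Fin nz → ℝ) → (Fin np → ℝ) → ℝ)
    (G : (Fin nz → ℝ) → (Fin np → ℝ) → Fin nG → ℝ)
    (H : (Fin nz → ℝ) → (Fin np → ℝ) → Fin nH → ℝ)
    (phat : Fin np → ℝ) (zhat : Fin nz → ℝ) (muhat : Fin nG → ℝ) (lamhat : Fin nH → ℝ) :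
    Prop :=
  -- `zhat` is feasible for NLP(phat)
  ((∀ j, H zhat phat j = 0) ∧ (∀ i, G zhat phat i ≤ 0)) ∧
  -- `zhat` is a local minimum of NLP(phat)
  IsLocalMinOn (fun z => J z phat)
    {z | (∀ j, H z phat j = 0) ∧ (∀ i, G z phat i ≤ 0)} zhat ∧
  -- (a) LICQ: gradients of active inequality constraints and equality constraints
  -- are linearly independent
  LinearIndependent ℝ
    (Sum.elim
      (fun i : {i : Fin nG // G zhat phat i = 0} => fderiv ℝ (fun z => G z phat i.1) zhat)
      (fun j : Fin nH => fderiv ℝ (fun z => H z phat j) zhat)) ∧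
  -- (b) KKT conditions
  (fderiv ℝ (fun z => Lagrangian J G H z muhat lamhat phat) zhat = 0 ∧
    (∀ i, 0 ≤ muhat i) ∧ ∑ i, muhat i * G zhat phat i = 0) ∧
  -- (c) strict complementarity
  (∀ i, 0 < muhat i - G zhat phat i) ∧
  -- (d) second-order condition on the critical subspace
  (∀ d : Fin nz → ℝ, d ≠ 0 →
    (∀ i, G zhat phat i = 0 → fderiv ℝ (fun z => G z phat i) zhat d = 0) →
    (∀ j, fderiv ℝ (fun z => H z phat j) zhat d = 0) →
    0 < fderiv ℝ (fun z => fderiv ℝ (fun w => Lagrangian J G H w muhat lamhat phat) z) zhat d d)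

open Filter Topology Set

theorem HasFDerivAt.tendsto_slope_prod {E Y : Type*} [NormedAddCommGroup E] [NormedSpace ℝ E]
    [NormedAddCommGroup Y] [NormedSpace ℝ Y] {F : E → Y} {A : E →L[ℝ] Y} {x : E}
    (hF : HasFDerivAt F A x) (d : E) :
    Tendsto (fun q : ℝ × E => q.1⁻¹ • (F (x + q.1 • q.2) - F x)) (𝓝[>] 0 ×ˢ 𝓝 d)
      (𝓝 (A d)) := by
  have hpos : ∀ᶠ q : ℝ × E in 𝓝[>] 0 ×ˢ 𝓝 d, 0 < q.1 :=
    tendsto_fst.eventually (eventually_mem_nhdsWithin (a := (0 : ℝ)) (s := Ioi 0))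
  refine (hF.hasFDerivWithinAt (s := univ)).lim (d := fun q : ℝ × E => q.1 • q.2) ?_ (by simp) ?_
  · have h0 : Tendsto (fun q : ℝ × E => q.1 • q.2) (𝓝[>] 0 ×ˢ 𝓝 d) (𝓝 ((0 : ℝ) • d)) :=
      (tendsto_fst.mono_right nhdsWithin_le_nhds).smul tendsto_snd
    rwa [zero_smul] at h0
  · refine Tendsto.congr' ?_ (tendsto_snd : Tendsto Prod.snd (𝓝[>] (0 : ℝ) ×ˢ 𝓝 d) (𝓝 d))
    filter_upwards [hpos] with q hq
    rw [inv_smul_smul₀ hq.ne']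

theorem eventually_lt_of_fderiv_pos {E : Type*} [NormedAddCommGroup E] [NormedSpace ℝ E]
    {f : E → ℝ} {x d : E} (hf : DifferentiableAt ℝ f x) (hd : 0 < fderiv ℝ f x d) :
    ∀ᶠ q : ℝ × E in 𝓝[>] 0 ×ˢ 𝓝 d, f x < f (x + q.1 • q.2) := by
  have hpos : ∀ᶠ q : ℝ × E in 𝓝[>] 0 ×ˢ 𝓝 d, 0 < q.1 :=
    tendsto_fst.eventually (eventually_mem_nhdsWithin (a := (0 : ℝ)) (s := Ioi 0))
  filter_upwards [hpos, (hf.hasFDerivAt.tendsto_slope_prod d).eventually (lt_mem_nhds hd)]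
    with q hq h
  rw [smul_eq_mul, mul_pos_iff_of_pos_left (inv_pos.2 hq)] at h
  linarith

theorem eventually_lt_of_hessian_pos {E : Type*} [NormedAddCommGroup E] [NormedSpace ℝ E]
    {f : E → ℝ} {x d : E} (hf : Differentiable ℝ f) (hf2 : DifferentiableAt ℝ (fderiv ℝ f) x)
    (h0 : fderiv ℝ f x = 0) (hd : 0 < fderiv ℝ (fderiv ℝ f) x d d) :
    ∀ᶠ q : ℝ × E in 𝓝[>] 0 ×ˢ 𝓝 d, f x < f (x + q.1 • q.2) := by
  have hpos : ∀ᶠ q : ℝ × E in 𝓝[>] 0 ×ˢ 𝓝 d, 0 < q.1 :=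
    tendsto_fst.eventually (eventually_mem_nhdsWithin (a := (0 : ℝ)) (s := Ioi 0))
  have hlim := (isBoundedBilinearMap_apply (𝕜 := ℝ) (E := E) (F := ℝ)).continuous.tendsto
    (fderiv ℝ (fderiv ℝ f) x d, d) |>.comp ((HasFDerivAt.tendsto_slope_prod hf2.hasFDerivAt d).prodMk_nhds
      (tendsto_snd : Tendsto Prod.snd (𝓝[>] (0 : ℝ) ×ˢ 𝓝 d) (𝓝 d)))
  have hev : ∀ᶠ q : ℝ × E in 𝓝[>] 0 ×ˢ 𝓝 d, 0 < fderiv ℝ f (x + q.1 • q.2) q.2 := by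
    filter_upwards [hpos, hlim.eventually (lt_mem_nhds hd)] with q hq h
    simp only [Function.comp_apply, h0, sub_zero, smul_apply, smul_eq_mul] at h
    rw [mul_pos_iff_of_pos_left (inv_pos.2 hq)] at h
    exact h
  obtain ⟨pa, hpa, pb, hpb, H⟩ := eventually_prod_iff.1 hev
  obtain ⟨u, hu, hsub⟩ := mem_nhdsGT_iff_exists_Ioo_subset.1 hpa
  refine eventually_prod_iff.2
    ⟨fun s => s ∈ Ioo 0 u, Ioo_mem_nhdsGT hu, pb, hpb, fun {s} hs {e} he => ?_⟩
  have hder : ∀ t : ℝ, HasDerivAt (fun t : ℝ => f (x + t • e)) (fderiv ℝ f (x + t • e) e) t := by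
    intro t
    have h1 : HasDerivAt (fun t : ℝ => x + t • e) e t := by
      simpa using ((hasDerivAt_id t).smul_const e).const_add x
    exact (hf (x + t • e)).hasFDerivAt.comp_hasDerivAt t h1
  have hmono : StrictMonoOn (fun t : ℝ => f (x + t • e)) (Icc 0 s) := by
    refine strictMonoOn_of_deriv_pos (convex_Icc 0 s)
      (fun t _ => (hder t).continuousAt.continuousWithinAt) fun t ht => ?_
    rw [interior_Icc] at ht
    rw [(hder t).deriv]
    exact H (hsub ⟨ht.1, ht.2.trans hs.2⟩) he
  simpa using hmono (left_mem_Icc.2 hs.1.le) (right_mem_Icc.2 hs.1.le) hs.1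

/-- A property that holds for all small positive steps along all directions near each unit vector
holds on a punctured neighbourhood. -/
theorem eventually_nhdsNE_of_forall_sphere {E : Type*} [NormedAddCommGroup E] [NormedSpace ℝ E]
    [FiniteDimensional ℝ E] {x : E} {P : E → Prop}
    (h : ∀ d ∈ sphere (0 : E) 1, ∀ᶠ q : ℝ × E in 𝓝[>] 0 ×ˢ 𝓝 d, P (x + q.1 • q.2)) :
    ∀ᶠ z in 𝓝[≠] x, P z := by
  have hall : ∀ᶠ t : ℝ in 𝓝[>] 0, ∀ d ∈ sphere (0 : E) 1, P (x + t • d) := by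
    have hK := isCompact_sphere (0 : E) 1
    have h' : ∀ᶠ q : ℝ × E in 𝓝[>] 0 ×ˢ 𝓝ˢ (sphere (0 : E) 1), P (x + q.1 • q.2) := by
      rw [hK.prod_nhdsSet_eq_biSup]
      simpa only [eventually_iSup] using h
    exact h'.curry.mono fun _ h => h.self_of_nhdsSet
  have hnorm : Tendsto (fun z : E => ‖z - x‖) (𝓝[≠] x) (𝓝[>] 0) := tendsto_norm_sub_self_nhdsNE x
  filter_upwards [hnorm.eventually hall, self_mem_nhdsWithin] with z hz hne
  have hne' : ‖z - x‖ ≠ 0 := norm_ne_zero_iff.2 (sub_ne_zero.2 hne)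
  have := hz (‖z - x‖⁻¹ • (z - x)) (by simp [norm_smul, hne'])
  rwa [smul_inv_smul₀ hne', add_sub_cancel] at this

/-- Second-order sufficient optimality condition under strict complementarity. -/
theorem isLocalMinOn_of_kkt_of_hessian_pos {E ι κ : Type*} [NormedAddCommGroup E] [NormedSpace ℝ E]
    [FiniteDimensional ℝ E] [Fintype ι] [Fintype κ] {f : E → ℝ} {g : ι → E → ℝ} {h : κ → E → ℝ}
    {x : E} {μ : ι → ℝ} {lam : κ → ℝ}
    (hf : Differentiable ℝ f) (hg : ∀ i, Differentiable ℝ (g i))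
    (hh : ∀ j, Differentiable ℝ (h j)) (hhx : ∀ j, h j x = 0)
    (hL : DifferentiableAt ℝ
      (fderiv ℝ fun z => f z + ∑ i, μ i * g i z + ∑ j, lam j * h j z) x)
    (hL0 : fderiv ℝ (fun z => f z + ∑ i, μ i * g i z + ∑ j, lam j * h j z) x = 0)
    (hμ : ∀ i, 0 ≤ μ i) (hcomp : ∀ i, μ i * g i x = 0) (hstrict : ∀ i, 0 < μ i - g i x)
    (hpos : ∀ d : E, d ≠ 0 → (∀ i, g i x = 0 → fderiv ℝ (g i) x d = 0) →
      (∀ j, fderiv ℝ (h j) x d = 0) →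
      0 < fderiv ℝ (fderiv ℝ fun z => f z + ∑ i, μ i * g i z + ∑ j, lam j * h j z) x d d) :
    IsLocalMinOn f {z | (∀ j, h j z = 0) ∧ ∀ i, g i z ≤ 0} x := by
  have hLdiff : Differentiable ℝ fun z => f z + ∑ i, μ i * g i z + ∑ j, lam j * h j z := by
    fun_prop
  have hLd : ∀ d, fderiv ℝ (fun z => f z + ∑ i, μ i * g i z + ∑ j, lam j * h j z) x d =
      fderiv ℝ f x d + ∑ i, μ i * fderiv ℝ (g i) x d + ∑ j, lam j * fderiv ℝ (h j) x d := by
    intro d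
    have hder := ((hf x).hasFDerivAt.fun_add (HasFDerivAt.fun_sum (u := Finset.univ) fun i _ =>
      ((hg i x).hasFDerivAt.const_mul (μ i)))).fun_add (HasFDerivAt.fun_sum (u := Finset.univ)
        fun j _ => ((hh j x).hasFDerivAt.const_mul (lam j)))
    have := congrArg (fun T => T d) hder.fderiv
    simpa using this
  have hLx : ∀ z, (∀ j, h j z = 0) →
      f z + ∑ i, μ i * g i z + ∑ j, lam j * h j z = f z + ∑ i, μ i * g i z := by
    intro z hz
    simp [hz]
  have key : ∀ᶠ z in 𝓝[≠] x, ((∀ j, h j z = 0) ∧ ∀ i, g i z ≤ 0) → f x ≤ f z := by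
    refine eventually_nhdsNE_of_forall_sphere fun d hd => ?_
    by_cases h1 : ∃ j, fderiv ℝ (h j) x d ≠ 0
    · obtain ⟨j, hj⟩ := h1
      rcases lt_or_gt_of_ne hj with hj | hj
      · have hneg : 0 < fderiv ℝ (fun z => -h j z) x d := by
          rw [fderiv_fun_neg]; simpa using hj
        filter_upwards [eventually_lt_of_fderiv_pos (hh j x).neg hneg] with q hq hfeas
        simp [hhx, hfeas.1] at hq
      · filter_upwards [eventually_lt_of_fderiv_pos (hh j x) hj] with q hq hfeas
        simp [hhx, hfeas.1] at hq
    push Not at h1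
    by_cases h2 : ∃ i, g i x = 0 ∧ 0 < fderiv ℝ (g i) x d
    · obtain ⟨i, hi, hpi⟩ := h2
      filter_upwards [eventually_lt_of_fderiv_pos (hg i x) hpi] with q hq hfeas
      rw [hi] at hq
      exact absurd (hfeas.2 i) (not_le.2 hq)
    push Not at h2
    by_cases h3 : 0 < fderiv ℝ f x d
    · filter_upwards [eventually_lt_of_fderiv_pos (hf x) h3] with q hq _ using hq.le
    have hterm : ∀ i, μ i * fderiv ℝ (g i) x d ≤ 0 := by
      intro i
      rcases mul_eq_zero.1 (hcomp i) with hi | hi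
      · simp [hi]
      · exact mul_nonpos_of_nonneg_of_nonpos (hμ i) (h2 i hi)
    have hsum0 : ∑ i, μ i * fderiv ℝ (g i) x d = 0 := by
      have h4 := hLd d
      rw [hL0] at h4
      simp only [h1, mul_zero, Finset.sum_const_zero, add_zero, zero_apply] at h4
      have := Finset.sum_nonpos fun i (_ : i ∈ Finset.univ) => hterm i
      linarith [not_lt.1 h3]
    have hzero := (Finset.sum_eq_zero_iff_of_nonpos fun i _ => hterm i).1 hsum0
    have hdpos := hpos d (ne_of_mem_sphere hd one_ne_zero) (fun i hi => by
      have := hstrict i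
      rw [hi, sub_zero] at this
      exact (mul_eq_zero.1 (hzero i (Finset.mem_univ i))).resolve_left this.ne') h1
    filter_upwards [eventually_lt_of_hessian_pos hLdiff hL hL0 hdpos] with q hq hfeas
    rw [hLx _ hfeas.1, hLx _ hhx] at hq
    simp only [hcomp, Finset.sum_const_zero, add_zero] at hq
    have := Finset.sum_nonpos fun i (_ : i ∈ Finset.univ) =>
      mul_nonpos_of_nonneg_of_nonpos (hμ i) (hfeas.2 i)
    linarith
  rw [eventually_nhdsWithin_iff] at key
  refine eventually_nhdsWithin_iff.2 (key.mono fun z hz hfeas => ?_)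
  by_cases hzx : z = x
  · rw [hzx]
  · exact hz hzx hfeas

theorem fderiv_prod_apply_eq_add {A B Y : Type*} [NormedAddCommGroup A] [NormedSpace ℝ A]
    [NormedAddCommGroup B] [NormedSpace ℝ B] [NormedAddCommGroup Y] [NormedSpace ℝ Y]
    {f : A × B → Y} {a : A} {b : B} (hf : DifferentiableAt ℝ f (a, b)) (da : A) (db : B) :
    fderiv ℝ f (a, b) (da, db) =
      fderiv ℝ (fun a' => f (a', b)) a da + fderiv ℝ (fun b' => f (a, b')) b db := by
  have h1 : HasFDerivAt (fun a' => f (a', b)) _ a :=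
    hf.hasFDerivAt.comp a (hasFDerivAt_prodMk_left a b)
  have h2 : HasFDerivAt (fun b' => f (a, b')) _ b :=
    hf.hasFDerivAt.comp b (hasFDerivAt_prodMk_right a b)
  rw [h1.fderiv, h2.fderiv]
  simp [← map_add]

section Sensitivity

variable {nz np nG nH : ℕ}
  {J : (Fin nz → ℝ) → (Fin np → ℝ) → ℝ}
  {G : (Fin nz → ℝ) → (Fin np → ℝ) → Fin nG → ℝ}
  {H : (Fin nz → ℝ) → (Fin np → ℝ) → Fin nH → ℝ}

/-- The gradient in `z` of the Lagrange function at a point `(p, z, μ, λ)`. -/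
noncomputable def lagrangianGradient
    (J : (Fin nz → ℝ) → (Fin np → ℝ) → ℝ)
    (G : (Fin nz → ℝ) → (Fin np → ℝ) → Fin nG → ℝ)
    (H : (Fin nz → ℝ) → (Fin np → ℝ) → Fin nH → ℝ)
    (v : (Fin np → ℝ) × (Fin nz → ℝ) × (Fin nG → ℝ) × (Fin nH → ℝ)) : (Fin nz → ℝ) →L[ℝ] ℝ :=
  fderiv ℝ (fun z => Lagrangian J G H z v.2.2.1 v.2.2.2 v.1) v.2.1

/-- The left-hand side of the equality part of the KKT system at a point `(p, z, μ, λ)`. -/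
noncomputable def kktMap
    (J : (Fin nz → ℝ) → (Fin np → ℝ) → ℝ)
    (G : (Fin nz → ℝ) → (Fin np → ℝ) → Fin nG → ℝ)
    (H : (Fin nz → ℝ) → (Fin np → ℝ) → Fin nH → ℝ)
    (v : (Fin np → ℝ) × (Fin nz → ℝ) × (Fin nG → ℝ) × (Fin nH → ℝ)) :
    ((Fin nz → ℝ) →L[ℝ] ℝ) × (Fin nG → ℝ) × (Fin nH → ℝ) :=
  (lagrangianGradient J G H v, fun i => v.2.2.1 i * G v.2.1 v.1 i, H v.2.1 v.1)

theorem contDiff_curried_comp {A Y : Type*} [NormedAddCommGroup A] [NormedSpace ℝ A]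
    [NormedAddCommGroup Y] [NormedSpace ℝ Y] {F : (Fin nz → ℝ) → (Fin np → ℝ) → Y}
    (hF : ContDiff ℝ 2 fun q : (Fin nz → ℝ) × (Fin np → ℝ) => F q.1 q.2)
    {a : A → Fin nz → ℝ} {b : A → Fin np → ℝ} (ha : ContDiff ℝ 2 a) (hb : ContDiff ℝ 2 b) :
    ContDiff ℝ 2 fun t => F (a t) (b t) :=
  hF.comp (ha.prodMk hb)

theorem contDiff_lagrangian_comp {A : Type*} [NormedAddCommGroup A] [NormedSpace ℝ A]
    (hJ : ContDiff ℝ 2 fun q : (Fin nz → ℝ) × (Fin np → ℝ) => J q.1 q.2)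
    (hG : ContDiff ℝ 2 fun q : (Fin nz → ℝ) × (Fin np → ℝ) => G q.1 q.2)
    (hH : ContDiff ℝ 2 fun q : (Fin nz → ℝ) × (Fin np → ℝ) => H q.1 q.2)
    {a : A → Fin nz → ℝ} {m : A → Fin nG → ℝ} {l : A → Fin nH → ℝ} {b : A → Fin np → ℝ}
    (ha : ContDiff ℝ 2 a) (hm : ContDiff ℝ 2 m) (hl : ContDiff ℝ 2 l) (hb : ContDiff ℝ 2 b) :
    ContDiff ℝ 2 fun t => Lagrangian J G H (a t) (m t) (l t) (b t) := by
  have h1 := contDiff_curried_comp hJ ha hb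
  have h2 := contDiff_pi.1 (contDiff_curried_comp hG ha hb)
  have h3 := contDiff_pi.1 (contDiff_curried_comp hH ha hb)
  have h4 := contDiff_pi.1 hm
  have h5 := contDiff_pi.1 hl
  unfold Lagrangian
  exact (h1.add (ContDiff.sum fun i _ => (h4 i).mul (h2 i))).add
    (ContDiff.sum fun j _ => (h5 j).mul (h3 j))

theorem contDiff_fderiv_curried {Y : Type*} [NormedAddCommGroup Y] [NormedSpace ℝ Y]
    {F : (Fin nz → ℝ) → (Fin np → ℝ) → Y}
    (hF : ContDiff ℝ 2 fun q : (Fin nz → ℝ) × (Fin np → ℝ) => F q.1 q.2) :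
    ContDiff ℝ 1 fun v : (Fin np → ℝ) × (Fin nz → ℝ) × (Fin nG → ℝ) × (Fin nH → ℝ) =>
      fderiv ℝ (fun z => F z v.1) v.2.1 := by
  refine ContDiff.fderiv (m := 2)
    (f := fun (v : (Fin np → ℝ) × (Fin nz → ℝ) × (Fin nG → ℝ) × (Fin nH → ℝ)) z => F z v.1)
    ?_ (by fun_prop) (by norm_num)
  exact contDiff_curried_comp hF (A := ((Fin np → ℝ) × (Fin nz → ℝ) × (Fin nG → ℝ) ×
    (Fin nH → ℝ)) × (Fin nz → ℝ)) contDiff_snd (contDiff_fst.comp contDiff_fst)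

theorem contDiff_lagrangianGradient
    (hJ : ContDiff ℝ 2 fun q : (Fin nz → ℝ) × (Fin np → ℝ) => J q.1 q.2)
    (hG : ContDiff ℝ 2 fun q : (Fin nz → ℝ) × (Fin np → ℝ) => G q.1 q.2)
    (hH : ContDiff ℝ 2 fun q : (Fin nz → ℝ) × (Fin np → ℝ) => H q.1 q.2) :
    ContDiff ℝ 1 (lagrangianGradient J G H) := by
  refine ContDiff.fderiv (m := 2)
    (f := fun (v : (Fin np → ℝ) × (Fin nz → ℝ) × (Fin nG → ℝ) × (Fin nH → ℝ)) z =>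
      Lagrangian J G H z v.2.2.1 v.2.2.2 v.1) ?_ (by fun_prop) (by norm_num)
  exact contDiff_lagrangian_comp hJ hG hH (A := ((Fin np → ℝ) × (Fin nz → ℝ) × (Fin nG → ℝ) ×
    (Fin nH → ℝ)) × (Fin nz → ℝ)) (by fun_prop) (by fun_prop) (by fun_prop) (by fun_prop)

theorem continuous_lagrangian_hessian
    (hJ : ContDiff ℝ 2 fun q : (Fin nz → ℝ) × (Fin np → ℝ) => J q.1 q.2)
    (hG : ContDiff ℝ 2 fun q : (Fin nz → ℝ) × (Fin np → ℝ) => G q.1 q.2)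
    (hH : ContDiff ℝ 2 fun q : (Fin nz → ℝ) × (Fin np → ℝ) => H q.1 q.2) :
    Continuous fun v : (Fin np → ℝ) × (Fin nz → ℝ) × (Fin nG → ℝ) × (Fin nH → ℝ) =>
      fderiv ℝ (fun z => fderiv ℝ (fun w => Lagrangian J G H w v.2.2.1 v.2.2.2 v.1) z) v.2.1 := by
  refine (ContDiff.fderiv (m := 1) (n := 0)
    (f := fun (v : (Fin np → ℝ) × (Fin nz → ℝ) × (Fin nG → ℝ) × (Fin nH → ℝ)) z =>
      lagrangianGradient J G H (v.1, z, v.2.2.1, v.2.2.2)) ?_ (by fun_prop) (by norm_num)).continuous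
  exact (contDiff_lagrangianGradient hJ hG hH).comp (by fun_prop : ContDiff ℝ 1
    fun q : ((Fin np → ℝ) × (Fin nz → ℝ) × (Fin nG → ℝ) × (Fin nH → ℝ)) × (Fin nz → ℝ) =>
      (q.1.1, q.2, q.1.2.2.1, q.1.2.2.2))

theorem contDiff_kktMap
    (hJ : ContDiff ℝ 2 fun q : (Fin nz → ℝ) × (Fin np → ℝ) => J q.1 q.2)
    (hG : ContDiff ℝ 2 fun q : (Fin nz → ℝ) × (Fin np → ℝ) => G q.1 q.2)
    (hH : ContDiff ℝ 2 fun q : (Fin nz → ℝ) × (Fin np → ℝ) => H q.1 q.2) :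
    ContDiff ℝ 1 (kktMap J G H) := by
  have h2 := contDiff_pi.1 (contDiff_curried_comp hG
    (A := (Fin np → ℝ) × (Fin nz → ℝ) × (Fin nG → ℝ) × (Fin nH → ℝ))
    (a := fun v => v.2.1) (b := fun v => v.1) (by fun_prop) (by fun_prop))
  have h3 := contDiff_curried_comp hH
    (A := (Fin np → ℝ) × (Fin nz → ℝ) × (Fin nG → ℝ) × (Fin nH → ℝ))
    (a := fun v => v.2.1) (b := fun v => v.1) (by fun_prop) (by fun_prop)
  refine (contDiff_lagrangianGradient hJ hG hH).prodMk (ContDiff.prodMk ?_ (h3.of_le (by norm_num)))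
  refine contDiff_pi.2 fun i => ContDiff.mul (by fun_prop) ((h2 i).of_le (by norm_num))

theorem differentiable_curried_left {Y : Type*} [NormedAddCommGroup Y] [NormedSpace ℝ Y]
    {F : (Fin nz → ℝ) → (Fin np → ℝ) → Y}
    (hF : ContDiff ℝ 2 fun q : (Fin nz → ℝ) × (Fin np → ℝ) => F q.1 q.2) (p : Fin np → ℝ) :
    Differentiable ℝ fun z => F z p :=
  (contDiff_curried_comp hF contDiff_id contDiff_const).differentiable (by norm_num)

theorem fderiv_lagrangian
    (hJ : ContDiff ℝ 2 fun q : (Fin nz → ℝ) × (Fin np → ℝ) => J q.1 q.2)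
    (hG : ContDiff ℝ 2 fun q : (Fin nz → ℝ) × (Fin np → ℝ) => G q.1 q.2)
    (hH : ContDiff ℝ 2 fun q : (Fin nz → ℝ) × (Fin np → ℝ) => H q.1 q.2)
    (z : Fin nz → ℝ) (μ : Fin nG → ℝ) (lam : Fin nH → ℝ) (p : Fin np → ℝ) :
    fderiv ℝ (fun z => Lagrangian J G H z μ lam p) z =
      fderiv ℝ (fun z => J z p) z + ∑ i, μ i • fderiv ℝ (fun z => G z p i) z +
        ∑ j, lam j • fderiv ℝ (fun z => H z p j) z := by
  have hG' := fun i => differentiable_pi.1 (differentiable_curried_left hG p) i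
  have hH' := fun j => differentiable_pi.1 (differentiable_curried_left hH p) j
  have hder := ((differentiable_curried_left hJ p z).hasFDerivAt.fun_add
    (HasFDerivAt.fun_sum (u := Finset.univ) fun i _ =>
      ((hG' i z).hasFDerivAt.const_mul (μ i)))).fun_add (HasFDerivAt.fun_sum (u := Finset.univ)
        fun j _ => ((hH' j z).hasFDerivAt.const_mul (lam j)))
  exact hder.fderiv

theorem fderiv_lagrangianGradient_apply
    (hJ : ContDiff ℝ 2 fun q : (Fin nz → ℝ) × (Fin np → ℝ) => J q.1 q.2)
    (hG : ContDiff ℝ 2 fun q : (Fin nz → ℝ) × (Fin np → ℝ) => G q.1 q.2)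
    (hH : ContDiff ℝ 2 fun q : (Fin nz → ℝ) × (Fin np → ℝ) => H q.1 q.2)
    (p dp : Fin np → ℝ) (z dz : Fin nz → ℝ) (μ dμ : Fin nG → ℝ) (lam dlam : Fin nH → ℝ) :
    fderiv ℝ (lagrangianGradient J G H) (p, z, μ, lam) (dp, dz, dμ, dlam) =
      fderiv ℝ (fun p => fderiv ℝ (fun z => Lagrangian J G H z μ lam p) z) p dp +
      (fderiv ℝ (fun z => fderiv ℝ (fun w => Lagrangian J G H w μ lam p) z) z dz +
        (∑ i, dμ i • fderiv ℝ (fun z => G z p i) z +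
          ∑ j, dlam j • fderiv ℝ (fun z => H z p j) z)) := by
  have hdiff := (contDiff_lagrangianGradient hJ hG hH).differentiable one_ne_zero
  have hdiff2 : Differentiable ℝ fun x => lagrangianGradient J G H (p, x) := by fun_prop
  rw [fderiv_prod_apply_eq_add (hdiff _), fderiv_prod_apply_eq_add (hdiff2 _)]
  congr 2
  let T : (Fin nG → ℝ) × (Fin nH → ℝ) →L[ℝ] (Fin nz → ℝ) →L[ℝ] ℝ :=
    ∑ i, ((ContinuousLinearMap.proj (R := ℝ) (φ := fun _ : Fin nG => ℝ) i).comp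
        (ContinuousLinearMap.fst ℝ _ _)).smulRight (fderiv ℝ (fun z => G z p i) z) +
      ∑ j, ((ContinuousLinearMap.proj (R := ℝ) (φ := fun _ : Fin nH => ℝ) j).comp
        (ContinuousLinearMap.snd ℝ _ _)).smulRight (fderiv ℝ (fun z => H z p j) z)
  have hm : HasFDerivAt (fun m : (Fin nG → ℝ) × (Fin nH → ℝ) =>
      lagrangianGradient J G H (p, z, m)) T (μ, lam) := by
    have heq : (fun m : (Fin nG → ℝ) × (Fin nH → ℝ) => lagrangianGradient J G H (p, z, m)) =
        fun m => fderiv ℝ (fun z => J z p) z + T m := by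
      funext m
      rw [lagrangianGradient, fderiv_lagrangian hJ hG hH, add_assoc]
      simp [T]
    rw [heq]
    exact T.hasFDerivAt.const_add _
  rw [hm.fderiv]
  simp [T]

theorem fderiv_kktMap_apply
    (hJ : ContDiff ℝ 2 fun q : (Fin nz → ℝ) × (Fin np → ℝ) => J q.1 q.2)
    (hG : ContDiff ℝ 2 fun q : (Fin nz → ℝ) × (Fin np → ℝ) => G q.1 q.2)
    (hH : ContDiff ℝ 2 fun q : (Fin nz → ℝ) × (Fin np → ℝ) => H q.1 q.2)
    (p dp : Fin np → ℝ) (z dz : Fin nz → ℝ) (μ dμ : Fin nG → ℝ) (lam dlam : Fin nH → ℝ) :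
    fderiv ℝ (kktMap J G H) (p, z, μ, lam) (dp, dz, dμ, dlam) =
      (fderiv ℝ (fun p => fderiv ℝ (fun z => Lagrangian J G H z μ lam p) z) p dp +
        (fderiv ℝ (fun z => fderiv ℝ (fun w => Lagrangian J G H w μ lam p) z) z dz +
          (∑ i, dμ i • fderiv ℝ (fun z => G z p i) z +
            ∑ j, dlam j • fderiv ℝ (fun z => H z p j) z)),
        fun i => μ i * (fderiv ℝ (fun z => G z p i) z dz + fderiv ℝ (fun p => G z p i) p dp) +
          dμ i * G z p i,
        fun j => fderiv ℝ (fun z => H z p j) z dz + fderiv ℝ (fun p => H z p j) p dp) := by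
  have hK := ((contDiff_kktMap hJ hG hH).differentiable one_ne_zero (p, z, μ, lam)).hasFDerivAt
  have hswap : HasFDerivAt
      (fun v : (Fin np → ℝ) × (Fin nz → ℝ) × (Fin nG → ℝ) × (Fin nH → ℝ) => (v.2.1, v.1))
      (((ContinuousLinearMap.fst ℝ _ _).comp (ContinuousLinearMap.snd ℝ _ _)).prod
        (ContinuousLinearMap.fst ℝ _ _)) (p, z, μ, lam) :=
    hasFDerivAt_snd.fst.prodMk hasFDerivAt_fst
  refine Prod.ext ?_ (Prod.ext (funext fun i => ?_) (funext fun j => ?_))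
  · have h1 : HasFDerivAt (lagrangianGradient J G H) _ _ := hK.fst
    simp only [← fderiv_lagrangianGradient_apply hJ hG hH, h1.fderiv]
    rfl
  · have hGi : DifferentiableAt ℝ
        (fun q : (Fin nz → ℝ) × (Fin np → ℝ) => G q.1 q.2 i) (z, p) :=
      differentiable_pi.1 (hG.differentiable (by norm_num)) i _
    have h1 := hasFDerivAt_pi'.1 hK.snd.fst i
    have h2 := hasFDerivAt_pi'.1 (hasFDerivAt_snd (𝕜 := ℝ) (p := ((p, z, μ, lam) :
      (Fin np → ℝ) × (Fin nz → ℝ) × (Fin nG → ℝ) × (Fin nH → ℝ)))).snd.fst i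
    have h3 := h2.mul (hGi.hasFDerivAt.comp (p, z, μ, lam) hswap)
    have h4 := congrArg (fun T => T (dp, dz, dμ, dlam)) (h1.unique h3)
    have h5 := fderiv_prod_apply_eq_add hGi dz dp
    simp only [← h5]
    simpa [mul_comm (dμ i)] using h4
  · have hHj : DifferentiableAt ℝ
        (fun q : (Fin nz → ℝ) × (Fin np → ℝ) => H q.1 q.2 j) (z, p) :=
      differentiable_pi.1 (hH.differentiable (by norm_num)) j _
    have h1 := hasFDerivAt_pi'.1 hK.snd.snd j
    have h3 := hHj.hasFDerivAt.comp (p, z, μ, lam) hswap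
    have h4 := congrArg (fun T => T (dp, dz, dμ, dlam)) (h1.unique h3)
    have h5 := fderiv_prod_apply_eq_add hHj dz dp
    simp only [← h5]
    simpa using h4

theorem StronglyRegular.mul_eq_zero {p : Fin np → ℝ} {z : Fin nz → ℝ} {μ : Fin nG → ℝ}
    {lam : Fin nH → ℝ} (h : StronglyRegular J G H p z μ lam) (i : Fin nG) : μ i * G z p i = 0 := by
  obtain ⟨⟨-, hg⟩, -, -, ⟨-, hμ, hsum⟩, -⟩ := h
  exact (Finset.sum_eq_zero_iff_of_nonpos fun i _ =>
    mul_nonpos_of_nonneg_of_nonpos (hμ i) (hg i)).1 hsum i (Finset.mem_univ i)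

theorem StronglyRegular.kktMap_eq_zero {p : Fin np → ℝ} {z : Fin nz → ℝ} {μ : Fin nG → ℝ}
    {lam : Fin nH → ℝ} (h : StronglyRegular J G H p z μ lam) :
    kktMap J G H (p, z, μ, lam) = 0 := by
  have hc := h.mul_eq_zero
  obtain ⟨⟨hh, -⟩, -, -, ⟨hL, -⟩, -⟩ := h
  exact Prod.ext hL (Prod.ext (funext hc) (funext hh))

theorem StronglyRegular.eq_zero_of_fderiv_kktMap_eq_zero
    (hJ : ContDiff ℝ 2 fun q : (Fin nz → ℝ) × (Fin np → ℝ) => J q.1 q.2)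
    (hG : ContDiff ℝ 2 fun q : (Fin nz → ℝ) × (Fin np → ℝ) => G q.1 q.2)
    (hH : ContDiff ℝ 2 fun q : (Fin nz → ℝ) × (Fin np → ℝ) => H q.1 q.2)
    {p : Fin np → ℝ} {z : Fin nz → ℝ} {μ : Fin nG → ℝ} {lam : Fin nH → ℝ}
    (h : StronglyRegular J G H p z μ lam)
    {x : (Fin nz → ℝ) × (Fin nG → ℝ) × (Fin nH → ℝ)}
    (hx : fderiv ℝ (kktMap J G H) (p, z, μ, lam) (0, x) = 0) : x = 0 := by
  have hc := h.mul_eq_zero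
  obtain ⟨-, -, hli, -, hstrict, hpos⟩ := h
  obtain ⟨dz, dμ, dlam⟩ := x
  rw [fderiv_kktMap_apply hJ hG hH] at hx
  simp only [map_zero, zero_add, add_zero, Prod.mk_eq_zero] at hx
  obtain ⟨hx1, hx2, hx3⟩ := hx
  have hinact : ∀ i, G z p i ≠ 0 → dμ i = 0 := by
    intro i hi
    have h2 := congrFun hx2 i
    have hμi := (_root_.mul_eq_zero.1 (hc i)).resolve_right hi
    simp only [hμi, zero_mul, zero_add, Pi.zero_apply] at h2
    exact (_root_.mul_eq_zero.1 h2).resolve_right hi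
  have hact : ∀ i, G z p i = 0 → fderiv ℝ (fun z => G z p i) z dz = 0 := by
    intro i hi
    have h2 := congrFun hx2 i
    have hμi := hstrict i
    rw [hi, sub_zero] at hμi
    simp only [hi, mul_zero, add_zero, Pi.zero_apply] at h2
    exact (_root_.mul_eq_zero.1 h2).resolve_left hμi.ne'
  have heq : ∀ j, fderiv ℝ (fun z => H z p j) z dz = 0 := fun j => congrFun hx3 j
  have hdz : dz = 0 := by
    by_contra hne
    have h1 := hpos dz hne hact heq
    have h2 := congrArg (fun T : (Fin nz → ℝ) →L[ℝ] ℝ => T dz) hx1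
    have h3 : ∑ i, dμ i * fderiv ℝ (fun z => G z p i) z dz = 0 := by
      refine Finset.sum_eq_zero fun i _ => ?_
      by_cases hi : G z p i = 0
      · rw [hact i hi, mul_zero]
      · rw [hinact i hi, zero_mul]
    simp only [add_apply, sum_apply, smul_apply, smul_eq_mul, zero_apply, h3, heq, mul_zero,
      Finset.sum_const_zero, add_zero] at h2
    exact h1.ne' h2
  subst hdz
  rw [map_zero, zero_add] at hx1
  classical
  have hsum := Fintype.linearIndependent_iff.1 hli
    (Sum.elim (fun i => dμ i.1) dlam) (by
      rw [Fintype.sum_sum_type]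
      simp only [Sum.elim_inl, Sum.elim_inr]
      rw [← hx1]
      congr 1
      rw [← Finset.sum_filter_of_ne (p := fun i => G z p i = 0) fun i _ hne =>
        by_contra fun hi => hne (by rw [hinact i hi, zero_smul])]
      exact (Finset.sum_subtype _ (by simp) fun i =>
        dμ i • fderiv ℝ (fun z => G z p i) z).symm)
  refine Prod.ext rfl (Prod.ext (funext fun i => ?_) (funext fun j => hsum (Sum.inr j)))
  by_cases hi : G z p i = 0
  · exact hsum (Sum.inl ⟨i, hi⟩)
  · exact hinact i hi

theorem linearIndependent_sumElim_subtype_congr {ι κ E : Type*} [AddCommGroup E] [Module ℝ E]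
    {P Q : ι → Prop} (hPQ : ∀ i, P i ↔ Q i) {a : ι → E} {b : κ → E}
    (h : LinearIndependent ℝ (Sum.elim (fun i : {i // P i} => a i.1) b)) :
    LinearIndependent ℝ (Sum.elim (fun i : {i // Q i} => a i.1) b) := by
  obtain rfl : P = Q := funext fun i => propext (hPQ i)
  exact h

/-- Near a strongly regular KKT triple, the equality part of the KKT system implies strong
regularity. -/
theorem StronglyRegular.eventually_of_kktMap_eq_zero
    (hJ : ContDiff ℝ 2 fun q : (Fin nz → ℝ) × (Fin np → ℝ) => J q.1 q.2)
    (hG : ContDiff ℝ 2 fun q : (Fin nz → ℝ) × (Fin np → ℝ) => G q.1 q.2)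
    (hH : ContDiff ℝ 2 fun q : (Fin nz → ℝ) × (Fin np → ℝ) => H q.1 q.2)
    {phat : Fin np → ℝ} {zhat : Fin nz → ℝ} {muhat : Fin nG → ℝ} {lamhat : Fin nH → ℝ}
    (hreg : StronglyRegular J G H phat zhat muhat lamhat) :
    ∀ᶠ v in 𝓝 (phat, zhat, muhat, lamhat), kktMap J G H v = 0 →
      StronglyRegular J G H v.1 v.2.1 v.2.2.1 v.2.2.2 := by
  have hGi : ∀ i, ContDiff ℝ 2 fun q : (Fin nz → ℝ) × (Fin np → ℝ) => G q.1 q.2 i :=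
    contDiff_pi.1 hG
  have hHj : ∀ j, ContDiff ℝ 2 fun q : (Fin nz → ℝ) × (Fin np → ℝ) => H q.1 q.2 j :=
    contDiff_pi.1 hH
  have cG : ∀ i, Continuous fun v : (Fin np → ℝ) × (Fin nz → ℝ) × (Fin nG → ℝ) × (Fin nH → ℝ) =>
      G v.2.1 v.1 i := fun i =>
    (hGi i).continuous.comp ((continuous_fst.comp continuous_snd).prodMk continuous_fst)
  have cμ : ∀ i, Continuous fun v : (Fin np → ℝ) × (Fin nz → ℝ) × (Fin nG → ℝ) × (Fin nH → ℝ) =>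
      v.2.2.1 i := fun i => by fun_prop
  have cdG : ∀ i, Continuous fun v : (Fin np → ℝ) × (Fin nz → ℝ) × (Fin nG → ℝ) × (Fin nH → ℝ) =>
      fderiv ℝ (fun z => G z v.1 i) v.2.1 := fun i =>
    (contDiff_fderiv_curried (F := fun z p => G z p i) (hGi i)).continuous
  have cdH : ∀ j, Continuous fun v : (Fin np → ℝ) × (Fin nz → ℝ) × (Fin nG → ℝ) × (Fin nH → ℝ) =>
      fderiv ℝ (fun z => H z v.1 j) v.2.1 := fun j =>
    (contDiff_fderiv_curried (F := fun z p => H z p j) (hHj j)).continuous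
  have cL := continuous_lagrangian_hessian hJ hG hH
  obtain ⟨⟨-, hfeas⟩, -, hli, ⟨-, hμ, -⟩, hstrict, hpos⟩ := hreg
  have ev1 : ∀ᶠ v in 𝓝 (phat, zhat, muhat, lamhat), ∀ i, 0 < v.2.2.1 i - G v.2.1 v.1 i :=
    eventually_all.2 fun i =>
      ((cμ i).sub (cG i)).continuousAt.eventually (lt_mem_nhds (hstrict i))
  have ev2 : ∀ᶠ v in 𝓝 (phat, zhat, muhat, lamhat), ∀ i,
      G zhat phat i ≠ 0 → G v.2.1 v.1 i < 0 := by
    refine eventually_all.2 fun i => ?_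
    by_cases hi : G zhat phat i = 0
    · simp [hi]
    · exact ((cG i).continuousAt.eventually
        (gt_mem_nhds (lt_of_le_of_ne (hfeas i) hi))).mono fun v hv _ => hv
  have ev3 : ∀ᶠ v in 𝓝 (phat, zhat, muhat, lamhat), ∀ i,
      G zhat phat i = 0 → 0 < v.2.2.1 i := by
    refine eventually_all.2 fun i => ?_
    by_cases hi : G zhat phat i = 0
    · have := hstrict i
      rw [hi, sub_zero] at this
      exact ((cμ i).continuousAt.eventually (lt_mem_nhds this)).mono fun v hv _ => hv
    · simp [hi]
  have ev4 : ∀ᶠ v in 𝓝 (phat, zhat, muhat, lamhat), LinearIndependent ℝ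
      (Sum.elim
        (fun i : {i : Fin nG // G zhat phat i = 0} => fderiv ℝ (fun z => G z v.1 i.1) v.2.1)
        (fun j : Fin nH => fderiv ℝ (fun z => H z v.1 j) v.2.1)) := by
    have hcont : Continuous
        fun v : (Fin np → ℝ) × (Fin nz → ℝ) × (Fin nG → ℝ) × (Fin nH → ℝ) =>
        (Sum.elim
          (fun i : {i : Fin nG // G zhat phat i = 0} => fderiv ℝ (fun z => G z v.1 i.1) v.2.1)
          (fun j : Fin nH => fderiv ℝ (fun z => H z v.1 j) v.2.1)) := by
      refine continuous_pi ?_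
      rintro (i | j)
      · exact cdG i.1
      · exact cdH j
    have hopen := isOpen_setOfPred_linearIndependent (𝕜 := ℝ) (E := (Fin nz → ℝ) →L[ℝ] ℝ)
      (ι := {i : Fin nG // G zhat phat i = 0} ⊕ Fin nH)
    exact (hopen.preimage hcont).mem_nhds hli
  have ev5 : ∀ᶠ v in 𝓝 (phat, zhat, muhat, lamhat), ∀ d ∈ sphere (0 : Fin nz → ℝ) 1,
      (∀ i, G zhat phat i = 0 → fderiv ℝ (fun z => G z v.1 i) v.2.1 d = 0) →
      (∀ j, fderiv ℝ (fun z => H z v.1 j) v.2.1 d = 0) →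
      0 < fderiv ℝ (fun z => fderiv ℝ
        (fun w => Lagrangian J G H w v.2.2.1 v.2.2.2 v.1) z) v.2.1 d d := by
    refine (isCompact_sphere (0 : Fin nz → ℝ) 1).eventually_forall_of_forall_eventually
      fun d hd => ?_
    by_cases h1 : ∃ i, G zhat phat i = 0 ∧ fderiv ℝ (fun z => G z phat i) zhat d ≠ 0
    · obtain ⟨i, hi, hne⟩ := h1
      have hc := ((cdG i).comp continuous_fst).clm_apply (continuous_snd (Y := Fin nz → ℝ))
      exact (hc.continuousAt (x := ((phat, zhat, muhat, lamhat), d)).eventually_ne hne).mono fun w hw hw' _ =>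
          absurd (hw' i hi) hw
    by_cases h2 : ∃ j, fderiv ℝ (fun z => H z phat j) zhat d ≠ 0
    · obtain ⟨j, hne⟩ := h2
      have hc := ((cdH j).comp continuous_fst).clm_apply (continuous_snd (Y := Fin nz → ℝ))
      exact (hc.continuousAt (x := ((phat, zhat, muhat, lamhat), d)).eventually_ne hne).mono fun w hw _ hw' =>
          absurd (hw' j) hw
    push Not at h1 h2
    have hc := ((cL.comp continuous_fst).clm_apply (continuous_snd (Y := Fin nz → ℝ))).clm_apply
      continuous_snd
    exact (hc.continuousAt.eventually (lt_mem_nhds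
      (hpos d (ne_of_mem_sphere hd one_ne_zero) h1 h2))).mono fun w hw _ _ => hw
  filter_upwards [ev1, ev2, ev3, ev4, ev5] with v h1 h2 h3 h4 h5 hK
  obtain ⟨p, z, μ, lam⟩ := v
  simp only at h1 h2 h3 h4 h5 ⊢
  have hL : fderiv ℝ (fun z => Lagrangian J G H z μ lam p) z = 0 := congrArg Prod.fst hK
  have hc : ∀ i, μ i * G z p i = 0 := fun i => congrFun (congrArg (fun k => k.2.1) hK) i
  have hh : ∀ j, H z p j = 0 := fun j => congrFun (congrArg (fun k => k.2.2) hK) j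
  have hactive : ∀ i, G zhat phat i = 0 → G z p i = 0 := fun i hi =>
    (_root_.mul_eq_zero.1 (hc i)).resolve_left (h3 i hi).ne'
  have hinactive : ∀ i, G zhat phat i ≠ 0 → μ i = 0 := fun i hi =>
    (_root_.mul_eq_zero.1 (hc i)).resolve_right (h2 i hi).ne
  have hiff : ∀ i, G zhat phat i = 0 ↔ G z p i = 0 := fun i =>
    ⟨hactive i, fun hi => by_contra fun hne => (h2 i hne).ne hi⟩
  have hGle : ∀ i, G z p i ≤ 0 := fun i => by
    by_cases hi : G zhat phat i = 0
    · exact (hactive i hi).le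
    · exact (h2 i hi).le
  have hμnn : ∀ i, 0 ≤ μ i := fun i => by
    by_cases hi : G zhat phat i = 0
    · exact (h3 i hi).le
    · exact (hinactive i hi).ge
  have hsosc : ∀ d : Fin nz → ℝ, d ≠ 0 →
      (∀ i, G z p i = 0 → fderiv ℝ (fun z => G z p i) z d = 0) →
      (∀ j, fderiv ℝ (fun z => H z p j) z d = 0) →
      0 < fderiv ℝ (fun z => fderiv ℝ (fun w => Lagrangian J G H w μ lam p) z) z d d := by
    intro d hd hdG hdH
    have hn : 0 < ‖d‖⁻¹ := inv_pos.2 (norm_pos_iff.2 hd)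
    have := h5 (‖d‖⁻¹ • d) (by simp [norm_smul, hd])
      (fun i hi => by rw [map_smul, hdG i (hactive i hi), smul_zero])
      (fun j => by rw [map_smul, hdH j, smul_zero])
    simp only [map_smul, smul_apply, smul_eq_mul] at this
    rwa [mul_pos_iff_of_pos_left hn, mul_pos_iff_of_pos_left hn] at this
  refine ⟨⟨hh, hGle⟩, ?_, linearIndependent_sumElim_subtype_congr hiff
    (a := fun i => fderiv ℝ (fun z => G z p i) z) h4,
    ⟨hL, hμnn, Finset.sum_eq_zero fun i _ => hc i⟩, h1, hsosc⟩
  have hLdiff : Differentiable ℝ fun z => fderiv ℝ (fun w => Lagrangian J G H w μ lam p) z :=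
    ((contDiff_lagrangianGradient hJ hG hH).comp (by fun_prop : ContDiff ℝ 1
      fun z : Fin nz → ℝ => (p, z, μ, lam))).differentiable one_ne_zero
  exact isLocalMinOn_of_kkt_of_hessian_pos (f := fun z => J z p) (g := fun i z => G z p i)
    (h := fun j z => H z p j) (differentiable_curried_left hJ p)
    (fun i => differentiable_pi.1 (differentiable_curried_left hG p) i)
    (fun j => differentiable_pi.1 (differentiable_curried_left hH p) j)
    hh (hLdiff z) hL hμnn hc h1 hsosc

/-- The partial derivative of the KKT map with respect to `(z, μ, λ)` is invertible at a strongly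
regular KKT triple. -/
theorem StronglyRegular.isInvertible_fderiv_kktMap
    (hJ : ContDiff ℝ 2 fun q : (Fin nz → ℝ) × (Fin np → ℝ) => J q.1 q.2)
    (hG : ContDiff ℝ 2 fun q : (Fin nz → ℝ) × (Fin np → ℝ) => G q.1 q.2)
    (hH : ContDiff ℝ 2 fun q : (Fin nz → ℝ) × (Fin np → ℝ) => H q.1 q.2)
    {p : Fin np → ℝ} {z : Fin nz → ℝ} {μ : Fin nG → ℝ} {lam : Fin nH → ℝ}
    (h : StronglyRegular J G H p z μ lam) :
    (fderiv ℝ (kktMap J G H) (p, z, μ, lam) ∘L .inr ℝ (Fin np → ℝ)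
      ((Fin nz → ℝ) × (Fin nG → ℝ) × (Fin nH → ℝ))).IsInvertible := by
  set T := fderiv ℝ (kktMap J G H) (p, z, μ, lam) ∘L .inr ℝ (Fin np → ℝ)
      ((Fin nz → ℝ) × (Fin nG → ℝ) × (Fin nH → ℝ)) with hT
  have hinj : Function.Injective T.toLinearMap := by
    refine (injective_iff_map_eq_zero T.toLinearMap).2 fun x hx => ?_
    exact h.eq_zero_of_fderiv_kktMap_eq_zero hJ hG hH hx
  have hdim : Module.finrank ℝ ((Fin nz → ℝ) × (Fin nG → ℝ) × (Fin nH → ℝ)) =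
      Module.finrank ℝ (((Fin nz → ℝ) →L[ℝ] ℝ) × (Fin nG → ℝ) × (Fin nH → ℝ)) := by
    have hdual : Module.finrank ℝ ((Fin nz → ℝ) →L[ℝ] ℝ) = nz := by
      rw [← (LinearMap.toContinuousLinearMap (𝕜 := ℝ) (E := Fin nz → ℝ) (F' := ℝ)).finrank_eq]
      simp
    simp [hdual]
  exact ⟨(T.toLinearMap.linearEquivOfInjective hinj hdim).toContinuousLinearEquiv, rfl⟩

end Sensitivity

/-- Sensitivity theorem (differentiability part): the locally defined solution map
`p ↦ (z*(p), μ*(p), λ*(p))` — the unique nearby strongly regular KKT triple of NLP(p) for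
`p` near `phat` — is continuously differentiable near `phat`, and its derivative at `phat`
satisfies the sensitivity linear system
`∇²zz L (z*)' + (G'z)ᵀ (μ*)' + (H'z)ᵀ (λ*)' = −∇²zp L`,
`Ξ̂ G'z (z*)' + Γ̂ (μ*)' = −Ξ̂ G'p`, `H'z (z*)' = −H'p`,
where `Ξ̂ = diag(muhat)`, `Γ̂ = diag(G(zhat,phat))`, all derivatives evaluated at
`(zhat, muhat, lamhat, phat)`. -/
theorem sensitivity_solution_differentiability
    {nz np nG nH : ℕ}
    (J : (Fin nz → ℝ) → (Fin np → ℝ) → ℝ)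
    (G : (Fin nz → ℝ) → (Fin np → ℝ) → Fin nG → ℝ)
    (H : (Fin nz → ℝ) → (Fin np → ℝ) → Fin nH → ℝ)
    (hJ : ContDiff ℝ 2 fun q : (Fin nz → ℝ) × (Fin np → ℝ) => J q.1 q.2)
    (hG : ContDiff ℝ 2 fun q : (Fin nz → ℝ) × (Fin np → ℝ) => G q.1 q.2)
    (hH : ContDiff ℝ 2 fun q : (Fin nz → ℝ) × (Fin np → ℝ) => H q.1 q.2)
    (phat : Fin np → ℝ) (zhat : Fin nz → ℝ) (muhat : Fin nG → ℝ) (lamhat : Fin nH → ℝ)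
    (hreg : StronglyRegular J G H phat zhat muhat lamhat) :
    ∃ ε > (0 : ℝ), ∃ δ > (0 : ℝ),
      ∃ (zs : (Fin np → ℝ) → Fin nz → ℝ)
        (μs : (Fin np → ℝ) → Fin nG → ℝ)
        (lams : (Fin np → ℝ) → Fin nH → ℝ),
        -- the map is the locally defined solution map:
        zs phat = zhat ∧ μs phat = muhat ∧ lams phat = lamhat ∧
        (∀ p ∈ ball phat ε,
          (zs p, μs p, lams p) ∈ ball (zhat, muhat, lamhat) δ ∧
          StronglyRegular J G H p (zs p) (μs p) (lams p) ∧
          ∀ (z : Fin nz → ℝ) (μ : Fin nG → ℝ) (lam : Fin nH → ℝ),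
            (z, μ, lam) ∈ ball (zhat, muhat, lamhat) δ →
            StronglyRegular J G H p z μ lam →
            (z, μ, lam) = (zs p, μs p, lams p)) ∧
        -- continuous differentiability in a neighborhood of phat
        ContDiffOn ℝ 1 zs (ball phat ε) ∧
        ContDiffOn ℝ 1 μs (ball phat ε) ∧
        ContDiffOn ℝ 1 lams (ball phat ε) ∧
        -- first row of the sensitivity linear system:
        -- ∇²zz L · (z*)'(phat) + (G'z)ᵀ (μ*)'(phat) + (H'z)ᵀ (λ*)'(phat) = −∇²zp L
        (∀ (q : Fin np → ℝ) (w : Fin nz → ℝ),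
          fderiv ℝ (fun z => fderiv ℝ
              (fun z' => Lagrangian J G H z' muhat lamhat phat) z) zhat
              (fderiv ℝ zs phat q) w
            + ∑ i, fderiv ℝ μs phat q i * fderiv ℝ (fun z => G z phat i) zhat w
            + ∑ j, fderiv ℝ lams phat q j * fderiv ℝ (fun z => H z phat j) zhat w
          = - fderiv ℝ (fun p => fderiv ℝ
              (fun z => Lagrangian J G H z muhat lamhat p) zhat) phat q w) ∧
        -- second row: Ξ̂ · G'z · (z*)'(phat) + Γ̂ · (μ*)'(phat) = −Ξ̂ · G'p
        (∀ (q : Fin np → ℝ) (i : Fin nG),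
          muhat i * fderiv ℝ (fun z => G z phat i) zhat (fderiv ℝ zs phat q)
            + G zhat phat i * fderiv ℝ μs phat q i
          = - (muhat i * fderiv ℝ (fun p => G zhat p i) phat q)) ∧
        -- third row: H'z · (z*)'(phat) = −H'p
        (∀ (q : Fin np → ℝ) (j : Fin nH),
          fderiv ℝ (fun z => H z phat j) zhat (fderiv ℝ zs phat q)
          = - fderiv ℝ (fun p => H zhat p j) phat q) := by
  set v₀ : (Fin np → ℝ) × (Fin nz → ℝ) × (Fin nG → ℝ) × (Fin nH → ℝ) :=
    (phat, zhat, muhat, lamhat) with hv₀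
  have hK : ContDiffAt ℝ 1 (kktMap J G H) v₀ := (contDiff_kktMap hJ hG hH).contDiffAt
  have hinv := hreg.isInvertible_fderiv_kktMap hJ hG hH
  have hK0 : kktMap J G H v₀ = 0 := hreg.kktMap_eq_zero
  obtain ⟨φ, hφ0, hφK, hφiff, hφC⟩ : ∃ φ : (Fin np → ℝ) →
      (Fin nz → ℝ) × (Fin nG → ℝ) × (Fin nH → ℝ), φ phat = (zhat, muhat, lamhat) ∧
      (∀ᶠ p in 𝓝 phat, kktMap J G H (p, φ p) = 0) ∧
      (∀ᶠ v in 𝓝 v₀, kktMap J G H v = 0 ↔ φ v.1 = v.2) ∧ ContDiffAt ℝ 1 φ phat := by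
    refine ⟨hK.implicitFunction one_ne_zero hinv, hK.implicitFunction_apply_self _ _, ?_, ?_,
      hK.contDiffAt_implicitFunction _ _⟩
    · simpa only [hK0] using hK.eventually_apply_implicitFunction one_ne_zero hinv
    · simpa only [hK0] using hK.eventually_apply_eq_iff_implicitFunction one_ne_zero hinv
  obtain ⟨ε₁, hε₁, δ, hδ, hball⟩ : ∃ ε₁ > 0, ∃ δ > 0, ∀ p ∈ ball phat ε₁,
      ∀ x ∈ ball (zhat, muhat, lamhat) δ, (kktMap J G H (p, x) = 0 ↔ φ p = x) ∧
        (kktMap J G H (p, x) = 0 → StronglyRegular J G H p x.1 x.2.1 x.2.2) := by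
    obtain ⟨r, hr, h⟩ := Metric.eventually_nhds_iff_ball.1
      (hφiff.and (hreg.eventually_of_kktMap_eq_zero hJ hG hH))
    refine ⟨r, hr, r, hr, fun p hp x hx => h (p, x) ?_⟩
    rw [hv₀, ← ball_prod_same]
    exact ⟨hp, hx⟩
  have hφδ : ∀ᶠ p in 𝓝 phat, φ p ∈ ball (zhat, muhat, lamhat) δ :=
    hφC.continuousAt.eventually (by rw [hφ0]; exact ball_mem_nhds _ hδ)
  obtain ⟨ε₂, hε₂, hball₂⟩ := Metric.eventually_nhds_iff_ball.1
    (hφδ.and (hφK.and (hφC.eventually (by simp))))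
  have hcd : ContDiffOn ℝ 1 φ (ball phat (min ε₁ ε₂)) := fun p hp =>
    (hball₂ p (ball_subset_ball (min_le_right _ _) hp)).2.2.contDiffWithinAt
  have hφd : HasFDerivAt φ (fderiv ℝ φ phat) phat :=
    (hφC.differentiableAt one_ne_zero).hasFDerivAt
  have hsens : ∀ q, fderiv ℝ (kktMap J G H) v₀ (q, fderiv ℝ φ phat q) = 0 := by
    intro q
    have h1 : HasFDerivAt (kktMap J G H) (fderiv ℝ (kktMap J G H) v₀) (phat, φ phat) := by
      rw [hφ0]
      exact (hK.differentiableAt one_ne_zero).hasFDerivAt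
    have h2 := h1.comp phat ((hasFDerivAt_id phat).prodMk hφd)
    have h3 : HasFDerivAt (fun p => kktMap J G H (p, φ p))
        (0 : (Fin np → ℝ) →L[ℝ] _) phat :=
      (hasFDerivAt_const 0 phat).congr_of_eventuallyEq hφK
    exact congrArg (fun T => T q) (h2.unique h3)
  have hz : ∀ q, fderiv ℝ (fun p => (φ p).1) phat q = (fderiv ℝ φ phat q).1 := fun q => by
    rw [hφd.fst.fderiv]; rfl
  have hm : ∀ q, fderiv ℝ (fun p => (φ p).2.1) phat q = (fderiv ℝ φ phat q).2.1 := fun q => by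
    rw [hφd.snd.fst.fderiv]; rfl
  have hl : ∀ q, fderiv ℝ (fun p => (φ p).2.2) phat q = (fderiv ℝ φ phat q).2.2 := fun q => by
    rw [hφd.snd.snd.fderiv]; rfl
  have hrows := fun q => (fderiv_kktMap_apply hJ hG hH phat q zhat (fderiv ℝ φ phat q).1 muhat
    (fderiv ℝ φ phat q).2.1 lamhat (fderiv ℝ φ phat q).2.2).symm.trans (hsens q)
  refine ⟨min ε₁ ε₂, lt_min hε₁ hε₂, δ, hδ, fun p => (φ p).1, fun p => (φ p).2.1,
    fun p => (φ p).2.2, by simp [hφ0], by simp [hφ0], by simp [hφ0], fun p hp => ?_,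
    hcd.fst, hcd.snd.fst, hcd.snd.snd, fun q w => ?_, fun q i => ?_, fun q j => ?_⟩
  · have hp₁ := ball_subset_ball (min_le_left _ _) hp
    obtain ⟨hmem, hKp, -⟩ := hball₂ p (ball_subset_ball (min_le_right _ _) hp)
    refine ⟨hmem, (hball p hp₁ _ hmem).2 hKp, fun z μ lam hx hsr => ?_⟩
    exact ((hball p hp₁ _ hx).1.1 hsr.kktMap_eq_zero).symm
  · have h := congrArg (fun k => k.1 w) (hrows q)
    simp only [add_apply, sum_apply, smul_apply, smul_eq_mul, Prod.fst_zero, zero_apply] at h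
    simp only [hz, hm, hl]
    linarith
  · have h := congrFun (congrArg (fun k => k.2.1) (hrows q)) i
    simp only [Prod.snd_zero, Prod.fst_zero, Pi.zero_apply] at h
    simp only [hz, hm]
    linarith
  · have h := congrFun (congrArg (fun k => k.2.2) (hrows q)) j
    simp only [Prod.snd_zero, Pi.zero_apply] at h
    simp only [hz]
    linarith
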